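/- For every k ∈ ℝ with cos k ∉ {−1, 1} and every j ∈ {0,1,2}, l ∈ {0,1}, the function λ_j is differentiable at k, 1 − λ_j(k)² > 0, and x_{j,l}(k) := (−1)^l · λ_j'(k)/√(1 − λ_j(k)²) satisfies x_{j,l}(k) = −(−1)^l · (2 sin k)/(7√(1 − A² cos²k)) · sin(ξ_j(k))/√(1 − (28/27)cos²(ξ_j(k))). -/

import Mathlib

noncomputable section

/-- The constant `A = 9√3/(7√7)`. -/
def Aconst : ℝ := 9 * Real.sqrt 3 / (7 * Real.sqrt 7)

/-- `ξ_j(k) = (1/3)·arccos(A·cos k) + 2jπ/3`. -/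
def xi (j : ℕ) (k : ℝ) : ℝ :=
  (1 / 3) * Real.arccos (Aconst * Real.cos k) + 2 * j * Real.pi / 3

/-- `λ_j(k) = (2√7/(3√3))·cos(ξ_j(k))`, the three roots of `9λ³ − 7λ − 2cos k = 0`. -/
def lam (j : ℕ) (k : ℝ) : ℝ :=
  (2 * Real.sqrt 7 / (3 * Real.sqrt 3)) * Real.cos (xi j k)

/-- `x_{j,l}(k) = (−1)^l · λ_j'(k)/√(1 − λ_j(k)²)`. -/
def xfun (j l : ℕ) (k : ℝ) : ℝ :=
  (-1) ^ l * deriv (lam j) k / Real.sqrt (1 - lam j k ^ 2)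

theorem Aconst_sq : Aconst ^ 2 = 243 / 343 := by
  rw [Aconst, div_pow, mul_pow, mul_pow, Real.sq_sqrt (by norm_num), Real.sq_sqrt (by norm_num)]
  norm_num

theorem lam_coeff_mul_Aconst :
    2 * Real.sqrt 7 / (3 * Real.sqrt 3) * Aconst = 6 / 7 := by
  have h3 : Real.sqrt 3 ≠ 0 := by positivity
  have h7 : Real.sqrt 7 ≠ 0 := by positivity
  rw [Aconst]
  field_simp
  norm_num

theorem lam_coeff_sq : (2 * Real.sqrt 7 / (3 * Real.sqrt 3)) ^ 2 = 28 / 27 := by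
  rw [div_pow, mul_pow, mul_pow, Real.sq_sqrt (by norm_num), Real.sq_sqrt (by norm_num)]
  norm_num

theorem lam_sq (j : ℕ) (k : ℝ) : lam j k ^ 2 = 28 / 27 * Real.cos (xi j k) ^ 2 := by
  rw [lam, mul_pow, lam_coeff_sq]

theorem abs_Aconst_mul_cos_lt_one (k : ℝ) : |Aconst * Real.cos k| < 1 := by
  rw [← sq_lt_one_iff_abs_lt_one, mul_pow, Aconst_sq]
  linarith [Real.cos_sq_le_one k]

theorem cos_three_mul_xi (j : ℕ) (k : ℝ) :
    Real.cos (3 * xi j k) = Aconst * Real.cos k := by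
  have h := abs_lt.1 (abs_Aconst_mul_cos_lt_one k)
  have e : 3 * xi j k = Real.arccos (Aconst * Real.cos k) + j * (2 * Real.pi) := by
    rw [xi]
    ring
  rw [e, Real.cos_add_nat_mul_two_pi, Real.cos_arccos h.1.le h.2.le]

theorem lam_cubic (j : ℕ) (k : ℝ) : 9 * lam j k ^ 3 - 7 * lam j k = 2 * Real.cos k := by
  have h := cos_three_mul_xi j k
  rw [Real.cos_three_mul] at h
  have hC := lam_coeff_sq
  have hA := lam_coeff_mul_Aconst
  rw [lam]
  set C := 2 * Real.sqrt 7 / (3 * Real.sqrt 3)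
  linear_combination 9 * C * Real.cos (xi j k) ^ 3 * hC + 7 / 3 * C * h +
    7 / 3 * Real.cos k * hA

theorem lam_sq_lt_one (j : ℕ) {k : ℝ} (hk1 : Real.cos k ≠ 1) (hk2 : Real.cos k ≠ -1) :
    lam j k ^ 2 < 1 := by
  have h := lam_cubic j k
  have h1 := (Real.cos_le_one k).lt_of_ne hk1
  have h2 := (Real.neg_one_le_cos k).lt_of_ne' hk2
  rw [sq_lt_one_iff_abs_lt_one, abs_lt]
  constructor
  · by_contra! hl
    nlinarith [mul_nonneg (neg_nonneg.2 (by linarith : lam j k + 1 ≤ 0))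
      (by nlinarith : 0 ≤ 9 * lam j k ^ 2 - 9 * lam j k + 2)]
  · by_contra! hl
    nlinarith [mul_nonneg (sub_nonneg.2 hl)
      (by nlinarith : 0 ≤ 9 * lam j k ^ 2 + 9 * lam j k + 2)]

theorem hasDerivAt_lam (j : ℕ) (k : ℝ) :
    HasDerivAt (lam j)
      (-(2 * Real.sin k / (7 * Real.sqrt (1 - Aconst ^ 2 * Real.cos k ^ 2))) *
        Real.sin (xi j k)) k := by
  have h := abs_lt.1 (abs_Aconst_mul_cos_lt_one k)
  have hxi : HasDerivAt (xi j) _ k :=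
    (((Real.hasDerivAt_arccos h.1.ne' h.2.ne).comp k
      ((Real.hasDerivAt_cos k).const_mul Aconst)).const_mul (1 / 3)).add_const
        (2 * j * Real.pi / 3)
  have hlam : HasDerivAt (lam j) _ k :=
    hxi.cos.const_mul (2 * Real.sqrt 7 / (3 * Real.sqrt 3))
  refine hlam.congr_deriv ?_
  rw [mul_pow]
  have hA := lam_coeff_mul_Aconst
  set C := 2 * Real.sqrt 7 / (3 * Real.sqrt 3)
  set S := Real.sqrt (1 - Aconst ^ 2 * Real.cos k ^ 2)
  have e : 2 * Real.sin k / (7 * S) = 2 / 7 * Real.sin k * (1 / S) := by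
    rw [div_mul_eq_div_div]
    ring
  rw [e]
  linear_combination -(1 / 3) * Real.sin (xi j k) * Real.sin k * (1 / S) * hA


/-- Eq. (4.9) of the paper. For `cos k ∉ {−1,1}`, `λ_j` is
differentiable at `k`, `1 − λ_j(k)² > 0`, and
`x_{j,l}(k) = −(−1)^l (2 sin k)/(7√(1 − A²cos²k)) · sin ξ_j(k)/√(1 − (28/27)cos²ξ_j(k))`. -/
theorem xfun_formula (k : ℝ) (hk1 : Real.cos k ≠ 1) (hk2 : Real.cos k ≠ -1) :
    ∀ j < 3, ∀ l < 2,
      DifferentiableAt ℝ (lam j) k ∧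
      0 < 1 - lam j k ^ 2 ∧
      xfun j l k =
        -(-1 : ℝ) ^ l * (2 * Real.sin k /
            (7 * Real.sqrt (1 - Aconst ^ 2 * Real.cos k ^ 2))) *
          (Real.sin (xi j k) /
            Real.sqrt (1 - (28 / 27) * Real.cos (xi j k) ^ 2)) := by
  intro j _ l _
  have hd := hasDerivAt_lam j k
  refine ⟨hd.differentiableAt, sub_pos.2 (lam_sq_lt_one j hk1 hk2), ?_⟩
  rw [xfun, hd.deriv, lam_sq]
  ring
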